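/- Under the reverse (f,Γ)-GAN assumptions (see context), and supposing additionally that inf_{θ∈Θ} D_f^{Γ̃}(P_θ‖μ_n) = 0 for all empirical distributions μ_n, the following holds ℙ-almost surely: D_f^Γ(P_{θ*_{n,m}}‖Q) ≤ sup_{h∈Γ̃,θ∈Θ}{ E_{P_Z}[h∘Φ_θ] − E_{P_{Z,m}}[h∘Φ_θ] } + sup_{h∈Γ̃,θ∈Θ}{ E_{P_{Z,m}}[h∘Φ_θ] − E_{P_Z}[h∘Φ_θ] } + sup_{h∈Γ̃}{ Λ_f^{Q_n}[h] − Λ_f^Q[h] } + (1 + (f*)'_+(z₀+β−α)) sup_{h∈Γ} inf_{h̃∈Γ̃} ‖h−h̃‖_∞ + ε^{opt}_{n,m}. -/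

import Mathlib

open MeasureTheory Set Filter Topology
open scoped ENNReal NNReal Classical

noncomputable section

/-- The interval `(a, b)` with `b` possibly infinite. -/
def Dom (a : ℝ) (b : EReal) : Set ℝ := {t : ℝ | a < t ∧ (t : EReal) < b}

/-- Legendre transform of `f` on `(a,b)`, with values in `(-∞, ∞]` (modeled by `EReal`). -/
def fStar (f : ℝ → ℝ) (a : ℝ) (b : EReal) (z : ℝ) : EReal :=
  ⨆ t ∈ Dom a b, ((z * t - f t : ℝ) : EReal)

/-- Real-valued version of the Legendre transform (junk value where it is `⊤`). -/
def fStarR (f : ℝ → ℝ) (a : ℝ) (b : EReal) (z : ℝ) : ℝ := (fStar f a b z).toReal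

/-- Right derivative of `g` at `z`. -/
def rderiv (g : ℝ → ℝ) (z : ℝ) : ℝ := derivWithin g (Ici z) z

/-- `z₀ := f'_+(1)`. -/
def zz (f : ℝ → ℝ) : ℝ := rderiv f 1

/-- Integral of an `EReal`-valued function: the Bochner integral if the function is
a.e. finite and integrable, and `⊤` otherwise. -/
def eIntegral {X : Type*} [MeasurableSpace X] (P : Measure X) (g : X → EReal) : EReal :=
  if (∀ᵐ x ∂P, g x ≠ ⊤) ∧ Integrable (fun x => (g x).toReal) P
  then ((∫ x, (g x).toReal ∂P : ℝ) : EReal) else ⊤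

/-- The generalized cumulant generating function `Λ_f^P[h]`. -/
def cgf {X : Type*} [MeasurableSpace X] (f : ℝ → ℝ) (a : ℝ) (b : EReal)
    (P : Measure X) (h : X → ℝ) : EReal :=
  ⨅ ν : ℝ, ((ν : EReal) + eIntegral P (fun x => fStar f a b (h x - ν)))

/-- Real-valued `Λ_f^P[h]`. -/
def cgfR {X : Type*} [MeasurableSpace X] (f : ℝ → ℝ) (a : ℝ) (b : EReal)
    (P : Measure X) (h : X → ℝ) : ℝ := (cgf f a b P h).toReal

/-- `Λ_f : ℝⁿ → ℝ` (with values in `EReal`). -/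
def lamVec (f : ℝ → ℝ) (a : ℝ) (b : EReal) {n : ℕ} (x : Fin n → ℝ) : EReal :=
  ⨅ ν : ℝ, ((ν : EReal) + ((n : ℝ)⁻¹ : EReal) * ∑ i, fStar f a b (x i - ν))

/-- Empirical measure of `n` points. -/
def empMeas {X : Type*} [MeasurableSpace X] (n : ℕ) (xs : Fin n → X) : Measure X :=
  (n : ℝ≥0∞)⁻¹ • ∑ i, Measure.dirac (xs i)

/-- The `(f,Γ)`-divergence `D_f^Γ(Q‖P)`. -/
def Dfg {X : Type*} [MeasurableSpace X] (f : ℝ → ℝ) (a : ℝ) (b : EReal)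
    (Γ : Set (X → ℝ)) (Q P : Measure X) : ℝ :=
  sSup {r : ℝ | ∃ h ∈ Γ, r = ∫ x, h x ∂Q - cgfR f a b P h}

/-- Empirical Rademacher complexity of `Ψ` at the sample `y`. -/
def empRad {Y : Type*} (Ψ : Set (Y → ℝ)) (n : ℕ) (y : Fin n → Y) : ℝ :=
  (2 ^ n : ℝ)⁻¹ * ∑ σ : Fin n → Bool,
    sSup {r : ℝ | ∃ ψ ∈ Ψ, r = (n : ℝ)⁻¹ * ∑ i, (if σ i then 1 else -1) * ψ (y i)}

/-- Rademacher complexity of `Ψ` relative to `P` with `n` samples. -/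
def rad {Y : Type*} [MeasurableSpace Y] (Ψ : Set (Y → ℝ)) (P : Measure Y) (n : ℕ) : ℝ :=
  ∫ y, empRad Ψ n y ∂(Measure.pi fun _ : Fin n => P)

/-- `Δ_{f,n}`. -/
def Δq (f : ℝ → ℝ) (a : ℝ) (b : EReal) (α β : ℝ) (n : ℕ) : ℝ :=
  sInf ((fun z => (n : ℝ) * (-z + (((n : ℝ) - 1) / (n : ℝ)) * fStarR f a b z
      + (1 / (n : ℝ)) * fStarR f a b (β - α + z))) '' Icc (zz f - (β - α)) (zz f))

/-- `sup_{h ∈ Γ} inf_{h̃ ∈ Γ̃} ‖h − h̃‖_∞`. -/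
def approxErr {X : Type*} (Γ Γt : Set (X → ℝ)) : ℝ :=
  sSup {r : ℝ | ∃ h ∈ Γ, r = sInf {s : ℝ | ∃ ht ∈ Γt, s = ⨆ x, |h x - ht x|}}

/-- A countable subset which is pointwise-limit dense. -/
def PtwiseDenseCount {X : Type*} (Γ : Set (X → ℝ)) : Prop :=
  ∃ Γ₀ ⊆ Γ, Γ₀.Countable ∧ ∀ h ∈ Γ, ∃ s : ℕ → X → ℝ,
    (∀ j, s j ∈ Γ₀) ∧ ∀ x, Tendsto (fun j => s j x) atTop (𝓝 (h x))

/-- The quantity `K_{f,Ψ,P,n}` from Definition 3.4: either `(f*)'_+` is Lipschitz on the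
relevant interval and `Ψ` contains a constant, in which case `K` is the minimum of the two
expressions, or `K` is the second expression. -/
def Kchoice (f : ℝ → ℝ) (a : ℝ) (b : EReal) (α β : ℝ) {Y : Type*} [MeasurableSpace Y]
    (Ψ : Set (Y → ℝ)) (P : Measure Y) (n : ℕ) (K : ℝ) : Prop :=
  (∃ L : ℝ≥0, LipschitzOnWith L (rderiv (fStarR f a b))
      (Icc (zz f - (β - α)) (zz f + (β - α))) ∧
    (∃ c : ℝ, (fun _ => c) ∈ Ψ) ∧
    K = min ((1 + 2 * (β - α) * (L : ℝ)) * rad Ψ P n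
        + (β - α) ^ 2 * (L : ℝ) / (2 * Real.sqrt n))
      (rderiv (fStarR f a b) (β - α + zz f) * (rad Ψ P n + (β - α) / (2 * Real.sqrt n))))
  ∨ K = rderiv (fStarR f a b) (β - α + zz f) * (rad Ψ P n + (β - α) / (2 * Real.sqrt n))

/-- Covering number of a (pseudo)metric space by `ε`-balls. -/
def coverNum (Θ : Type*) [PseudoMetricSpace Θ] (ε : ℝ) : ℝ≥0∞ :=
  ⨅ s ∈ {s : Finset Θ | ∀ θ : Θ, ∃ c ∈ s, dist θ c ≤ ε}, ((s.card : ℝ≥0∞))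

end

section Legendre

variable {f : ℝ → ℝ} {a : ℝ} {b : EReal}

lemma coe_le_fStar {z t : ℝ} (ht : t ∈ Dom a b) :
    ((z * t - f t : ℝ) : EReal) ≤ fStar f a b z :=
  le_iSup₂ (f := fun t (_ : t ∈ Dom a b) => ((z * t - f t : ℝ) : EReal)) t ht

lemma fStar_le {z : ℝ} {c : EReal} (h : ∀ t ∈ Dom a b, ((z * t - f t : ℝ) : EReal) ≤ c) :
    fStar f a b z ≤ c :=
  iSup₂_le h

lemma self_le_fStar (h1 : (1 : ℝ) ∈ Dom a b) (hf1 : f 1 = 0) (z : ℝ) :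
    (z : EReal) ≤ fStar f a b z := by
  simpa [hf1] using coe_le_fStar (f := f) (z := z) h1

lemma fStar_ne_bot (h1 : (1 : ℝ) ∈ Dom a b) (z : ℝ) : fStar f a b z ≠ ⊥ :=
  ((EReal.bot_lt_coe _).trans_le (coe_le_fStar h1)).ne'

lemma le_fStarR {z t : ℝ} (ht : t ∈ Dom a b) (hz : fStar f a b z < ⊤) :
    z * t - f t ≤ fStarR f a b z := by
  have h := EReal.toReal_le_toReal (coe_le_fStar (f := f) (z := z) ht)
    (EReal.coe_ne_bot _) hz.ne
  rwa [EReal.toReal_coe] at h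

lemma fStarR_le (h1 : (1 : ℝ) ∈ Dom a b) {z c : ℝ} (h : ∀ t ∈ Dom a b, z * t - f t ≤ c) :
    fStarR f a b z ≤ c := by
  have h' : fStar f a b z ≤ (c : EReal) := fStar_le fun t ht => by exact_mod_cast h t ht
  simpa [fStarR] using EReal.toReal_le_toReal h' (fStar_ne_bot h1 z) (EReal.coe_ne_top c)

lemma fStar_mono (ha0 : 0 ≤ a) : Monotone (fStar f a b) := by
  intro x y hxy
  refine fStar_le fun t ht => le_trans ?_ (coe_le_fStar ht)
  have h0 : 0 ≤ t := ha0.trans ht.1.le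
  exact_mod_cast sub_le_sub_right (mul_le_mul_of_nonneg_right hxy h0) _

lemma measurable_fStar (ha0 : 0 ≤ a) : Measurable (fStar f a b) :=
  (fStar_mono ha0).measurable

lemma convexOn_fStarR (h1 : (1 : ℝ) ∈ Dom a b) :
    ConvexOn ℝ {z : ℝ | fStar f a b z < ⊤} (fStarR f a b) := by
  have key : ∀ ⦃x⦄, x ∈ {z : ℝ | fStar f a b z < ⊤} → ∀ ⦃y⦄,
      y ∈ {z : ℝ | fStar f a b z < ⊤} → ∀ ⦃p q : ℝ⦄, 0 ≤ p → 0 ≤ q → p + q = 1 →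
      ∀ t ∈ Dom a b, (p * x + q * y) * t - f t ≤ p * fStarR f a b x + q * fStarR f a b y := by
    intro x hx y hy p q hp hq hpq t ht
    have h₁ := mul_le_mul_of_nonneg_left (le_fStarR ht hx) hp
    have h₂ := mul_le_mul_of_nonneg_left (le_fStarR ht hy) hq
    have h₃ : f t = p * f t + q * f t := by rw [← add_mul, hpq, one_mul]
    linarith
  refine ⟨fun x hx y hy p q hp hq hpq => ?_, fun x hx y hy p q hp hq hpq => ?_⟩
  · refine (fStar_le (c := ((p * fStarR f a b x + q * fStarR f a b y : ℝ) : EReal))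
      fun t ht => ?_).trans_lt (EReal.coe_lt_top _)
    exact_mod_cast key hx hy hp hq hpq t ht
  · exact fStarR_le h1 (key hx hy hp hq hpq)

lemma zz_mul_le (hconv : ConvexOn ℝ (Dom a b) f) (hint : (1 : ℝ) ∈ interior (Dom a b))
    (hf1 : f 1 = 0) {t : ℝ} (ht : t ∈ Dom a b) : zz f * (t - 1) ≤ f t := by
  have hz : zz f = derivWithin f (Ioi 1) 1 := (derivWithin_Ioi_eq_Ici f 1).symm
  rcases lt_trichotomy t 1 with h | rfl | h
  · have h₁ := (hconv.slope_le_leftDeriv_of_mem_interior ht hint h).trans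
      (hconv.leftDeriv_le_rightDeriv_of_mem_interior hint)
    rw [slope_def_field, hf1, ← hz, div_le_iff₀ (by linarith)] at h₁
    linarith
  · simp [hf1]
  · have h₁ := hconv.rightDeriv_le_slope_of_mem_interior hint ht h
    rw [slope_def_field, hf1, ← hz, le_div_iff₀ (by linarith)] at h₁
    linarith

lemma fStar_zz_le (hsub : ∀ t ∈ Dom a b, zz f * (t - 1) ≤ f t) :
    fStar f a b (zz f) ≤ zz f := by
  refine fStar_le fun t ht => ?_
  have := hsub t ht
  exact_mod_cast (by linarith : zz f * t - f t ≤ zz f)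

lemma one_le_rderiv_fStarR (h1 : (1 : ℝ) ∈ Dom a b) (hf1 : f 1 = 0)
    (hsub : ∀ t ∈ Dom a b, zz f * (t - 1) ≤ f t) {w : ℝ} (hzw : zz f ≤ w)
    (hw : w ∈ interior {z : ℝ | fStar f a b z < ⊤}) : 1 ≤ rderiv (fStarR f a b) w := by
  have hd := (convexOn_fStarR h1).hasDerivWithinAt_rightDeriv_of_mem_interior hw
  have hfin : ∀ᶠ y in 𝓝[>] w, fStar f a b y < ⊤ :=
    mem_nhdsWithin_of_mem_nhds (mem_interior_iff_mem_nhds.1 hw)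
  rw [rderiv, ← derivWithin_Ioi_eq_Ici]
  refine ge_of_tendsto ((hasDerivWithinAt_iff_tendsto_slope' self_notMem_Ioi).mp hd) ?_
  filter_upwards [hfin, self_mem_nhdsWithin] with y hy hwy
  have hwy : w < y := hwy
  rw [slope_def_field, le_div_iff₀ (by linarith)]
  have hle : fStarR f a b w ≤ fStarR f a b y - (y - w) := by
    refine fStarR_le h1 fun t ht => ?_
    rcases le_total 1 t with h | h
    · nlinarith [le_fStarR ht hy]
    · have h₁ := le_fStarR h1 hy
      rw [hf1] at h₁
      nlinarith [hsub t ht]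
  linarith

end Legendre

section CumulantGenerating

variable {X : Type*} [MeasurableSpace X] {f : ℝ → ℝ} {a : ℝ} {b : EReal}
  {P : Measure X} {h k : X → ℝ} {α β : ℝ}

lemma eIntegral_le_of_le {g₁ g₂ : X → EReal} {l : X → ℝ} (hg₁ : Measurable g₁)
    (hl : Integrable l P) (hlg : ∀ x, (l x : EReal) ≤ g₁ x) (hg : ∀ x, g₁ x ≤ g₂ x) :
    eIntegral P g₁ ≤ eIntegral P g₂ := by
  unfold eIntegral
  split_ifs with h₁ h₂ h₂
  · refine EReal.coe_le_coe_iff.2 (integral_mono_ae h₁.2 h₂.2 ?_)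
    filter_upwards [h₂.1] with x hx
    exact EReal.toReal_le_toReal (hg x) ((EReal.bot_lt_coe _).trans_le (hlg x)).ne' hx
  · exact le_top
  · refine absurd ⟨?_, ?_⟩ h₁
    · filter_upwards [h₂.1] with x hx
      exact ((hg x).trans_lt hx.lt_top).ne
    · refine integrable_of_le_of_le hg₁.ereal_toReal.aestronglyMeasurable ?_ ?_ hl h₂.2
      · filter_upwards [h₂.1] with x hx
        simpa using EReal.toReal_le_toReal (hlg x) (EReal.coe_ne_bot _)
          ((hg x).trans_lt hx.lt_top).ne
      · filter_upwards [h₂.1] with x hx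
        exact EReal.toReal_le_toReal (hg x) ((EReal.bot_lt_coe _).trans_le (hlg x)).ne' hx
  · exact le_rfl

lemma eIntegral_coe (hi : Integrable h P) :
    eIntegral P (fun x => (h x : EReal)) = ((∫ x, h x ∂P : ℝ) : EReal) := by
  simp [eIntegral, hi]

variable [IsProbabilityMeasure P]

lemma integrable_of_mem_Icc (hm : Measurable h) (hb : ∀ x, h x ∈ Icc α β) :
    Integrable h P :=
  .of_mem_Icc α β hm.aemeasurable (ae_of_all _ hb)

lemma integral_mem_Icc (hm : Measurable h) (hb : ∀ x, h x ∈ Icc α β) :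
    ∫ x, h x ∂P ∈ Icc α β := by
  have hi : Integrable h P := integrable_of_mem_Icc hm hb
  constructor
  · simpa using integral_mono (integrable_const (μ := P) α) hi fun x => (hb x).1
  · simpa using integral_mono hi (integrable_const (μ := P) β) fun x => (hb x).2

lemma cgf_le_cgf_add (ha0 : 0 ≤ a) (h1 : (1 : ℝ) ∈ Dom a b) (hf1 : f 1 = 0)
    (hm : Measurable h) (hi : Integrable h P) {c : ℝ} (hk : ∀ x, h x ≤ k x + c) :
    cgf f a b P h ≤ cgf f a b P k + c := by
  rw [← EReal.sub_le_iff_le_add (by simp) (by simp)]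
  refine le_iInf fun ν => ?_
  rw [EReal.sub_le_iff_le_add (by simp) (by simp)]
  have hle : eIntegral P (fun x => fStar f a b (h x - (ν + c))) ≤
      eIntegral P (fun x => fStar f a b (k x - ν)) :=
    eIntegral_le_of_le ((measurable_fStar ha0).comp (hm.sub_const _))
      (hi.sub (integrable_const (ν + c))) (fun x => self_le_fStar h1 hf1 _)
      fun x => fStar_mono ha0 (by linarith [hk x])
  calc cgf f a b P h
      ≤ ((ν + c : ℝ) : EReal) + eIntegral P (fun x => fStar f a b (h x - (ν + c))) :=
        iInf_le _ (ν + c)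
    _ ≤ ((ν + c : ℝ) : EReal) + eIntegral P (fun x => fStar f a b (k x - ν)) := by gcongr
    _ = _ := by rw [EReal.coe_add]; abel

lemma integral_le_cgf (h1 : (1 : ℝ) ∈ Dom a b) (hf1 : f 1 = 0)
    (hm : Measurable h) (hi : Integrable h P) :
    ((∫ x, h x ∂P : ℝ) : EReal) ≤ cgf f a b P h := by
  refine le_iInf fun ν => ?_
  have hi' : Integrable (fun x => h x - ν) P := hi.sub (integrable_const ν)
  have hle : eIntegral P (fun x => ((h x - ν : ℝ) : EReal)) ≤
      eIntegral P (fun x => fStar f a b (h x - ν)) :=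
    eIntegral_le_of_le (hm.sub_const ν).coe_real_ereal hi' (fun _ => le_rfl)
      fun x => self_le_fStar h1 hf1 _
  rw [eIntegral_coe hi', integral_sub hi (integrable_const ν)] at hle
  calc ((∫ x, h x ∂P : ℝ) : EReal)
      = (ν : EReal) + ((∫ x, h x ∂P - ∫ _, ν ∂P : ℝ) : EReal) := by
        rw [← EReal.coe_add]; simp
    _ ≤ _ := by gcongr

lemma cgf_le (ha0 : 0 ≤ a) (h1 : (1 : ℝ) ∈ Dom a b) (hf1 : f 1 = 0)
    (hsub : ∀ t ∈ Dom a b, zz f * (t - 1) ≤ f t)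
    (hm : Measurable h) (hi : Integrable h P) (hβ : ∀ x, h x ≤ β) :
    cgf f a b P h ≤ β := by
  have hle : eIntegral P (fun x => fStar f a b (h x - (β - zz f))) ≤
      eIntegral P (fun _ => ((zz f : ℝ) : EReal)) :=
    eIntegral_le_of_le ((measurable_fStar ha0).comp (hm.sub_const _))
      (hi.sub (integrable_const (β - zz f))) (fun x => self_le_fStar h1 hf1 _)
      fun x => (fStar_mono ha0 (by linarith [hβ x])).trans (fStar_zz_le hsub)
  rw [eIntegral_coe (integrable_const _)] at hle
  calc cgf f a b P h
      ≤ ((β - zz f : ℝ) : EReal) + eIntegral P (fun x => fStar f a b (h x - (β - zz f))) :=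
        iInf_le _ (β - zz f)
    _ ≤ ((β - zz f : ℝ) : EReal) + ((∫ _, zz f ∂P : ℝ) : EReal) := by gcongr
    _ = β := by rw [← EReal.coe_add]; simp

lemma coe_cgfR (ha0 : 0 ≤ a) (h1 : (1 : ℝ) ∈ Dom a b) (hf1 : f 1 = 0)
    (hsub : ∀ t ∈ Dom a b, zz f * (t - 1) ≤ f t)
    (hm : Measurable h) (hb : ∀ x, h x ∈ Icc α β) :
    (cgfR f a b P h : EReal) = cgf f a b P h := by
  have hi : Integrable h P := integrable_of_mem_Icc hm hb
  exact EReal.coe_toReal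
    ((cgf_le ha0 h1 hf1 hsub hm hi fun x => (hb x).2).trans_lt (EReal.coe_lt_top β)).ne
    ((EReal.bot_lt_coe _).trans_le (integral_le_cgf h1 hf1 hm hi)).ne'

lemma cgfR_mem_Icc (ha0 : 0 ≤ a) (h1 : (1 : ℝ) ∈ Dom a b) (hf1 : f 1 = 0)
    (hsub : ∀ t ∈ Dom a b, zz f * (t - 1) ≤ f t)
    (hm : Measurable h) (hb : ∀ x, h x ∈ Icc α β) :
    cgfR f a b P h ∈ Icc α β := by
  have hi : Integrable h P := integrable_of_mem_Icc hm hb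
  have hc := coe_cgfR (P := P) ha0 h1 hf1 hsub hm hb
  constructor
  · refine (integral_mem_Icc (P := P) hm hb).1.trans ?_
    rw [← EReal.coe_le_coe_iff, hc]
    exact integral_le_cgf h1 hf1 hm hi
  · rw [← EReal.coe_le_coe_iff, hc]
    exact cgf_le ha0 h1 hf1 hsub hm hi fun x => (hb x).2

lemma cgfR_le_cgfR_add (ha0 : 0 ≤ a) (h1 : (1 : ℝ) ∈ Dom a b) (hf1 : f 1 = 0)
    (hsub : ∀ t ∈ Dom a b, zz f * (t - 1) ≤ f t)
    (hm : Measurable h) (hb : ∀ x, h x ∈ Icc α β)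
    (hkm : Measurable k) (hkb : ∀ x, k x ∈ Icc α β) {c : ℝ} (hk : ∀ x, h x ≤ k x + c) :
    cgfR f a b P h ≤ cgfR f a b P k + c := by
  rw [← EReal.coe_le_coe_iff, EReal.coe_add, coe_cgfR ha0 h1 hf1 hsub hm hb,
    coe_cgfR ha0 h1 hf1 hsub hkm hkb]
  exact cgf_le_cgf_add ha0 h1 hf1 hm (integrable_of_mem_Icc hm hb) hk

end CumulantGenerating

lemma isProbabilityMeasure_empMeas {X : Type*} [MeasurableSpace X] {n : ℕ} (hn : 0 < n)
    (xs : Fin n → X) : IsProbabilityMeasure (empMeas n xs) := by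
  refine ⟨?_⟩
  simp only [empMeas, Measure.smul_apply, Measure.finsetSum_apply, measure_univ, smul_eq_mul,
    Finset.sum_const, Finset.card_univ, Fintype.card_fin, nsmul_eq_mul, mul_one]
  exact ENNReal.inv_mul_cancel (by exact_mod_cast hn.ne') (ENNReal.natCast_ne_top n)

lemma exists_abs_sub_le_approxErr_add {X : Type*} {Γ Γt : Set (X → ℝ)} {α β : ℝ}
    (hΓtne : Γt.Nonempty) (hb : ∀ h ∈ Γ, ∀ x, h x ∈ Icc α β)
    (htb : ∀ h ∈ Γt, ∀ x, h x ∈ Icc α β) {h : X → ℝ} (hh : h ∈ Γ) {δ : ℝ} (hδ : 0 < δ) :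
    ∃ k ∈ Γt, ∀ x, |h x - k x| ≤ approxErr Γ Γt + δ := by
  have habs : ∀ h ∈ Γ, ∀ k ∈ Γt, ∀ x, |h x - k x| ≤ β - α := fun h hh k hk x =>
    abs_sub_le_of_le_of_le (hb h hh x).1 (hb h hh x).2 (htb k hk x).1 (htb k hk x).2
  have hne : ∀ h : X → ℝ, {s : ℝ | ∃ k ∈ Γt, s = ⨆ x, |h x - k x|}.Nonempty := fun h =>
    hΓtne.imp' (fun k => ⨆ x, |h x - k x|) fun k hk => ⟨k, hk, rfl⟩
  have hbelow : ∀ h : X → ℝ, BddBelow {s : ℝ | ∃ k ∈ Γt, s = ⨆ x, |h x - k x|} := by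
    intro h
    refine ⟨0, ?_⟩
    rintro s ⟨k, -, rfl⟩
    exact Real.iSup_nonneg fun x => abs_nonneg _
  have habove : BddAbove
      {r : ℝ | ∃ h ∈ Γ, r = sInf {s : ℝ | ∃ k ∈ Γt, s = ⨆ x, |h x - k x|}} := by
    obtain ⟨k, hk⟩ := hΓtne
    refine ⟨max (β - α) 0, ?_⟩
    rintro r ⟨h, hh, rfl⟩
    exact (csInf_le (hbelow h) ⟨k, hk, rfl⟩).trans <| Real.iSup_le
      (fun x => (habs h hh k hk x).trans (le_max_left _ _)) (le_max_right _ _)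
  obtain ⟨s, ⟨k, hk, rfl⟩, hs⟩ := exists_lt_of_csInf_lt (hne h)
    (lt_add_of_pos_right (sInf {s : ℝ | ∃ k ∈ Γt, s = ⨆ x, |h x - k x|}) hδ)
  refine ⟨k, hk, fun x => ?_⟩
  have hx : |h x - k x| ≤ ⨆ x, |h x - k x| :=
    le_ciSup (f := fun x => |h x - k x|) ⟨β - α, by rintro _ ⟨y, rfl⟩; exact habs h hh k hk y⟩ x
  have hsup := le_csSup habove ⟨h, hh, rfl⟩
  rw [approxErr]
  linarith

open MeasureTheory in
/-- Reverse `(f,Γ)`-GAN error decomposition under the zero generator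
approximation error property. -/
theorem stmt18
    {X : Type*} [TopologicalSpace X] [MeasurableSpace X] [BorelSpace X]
    (f : ℝ → ℝ) (a : ℝ) (b : EReal) (α β : ℝ)
    (ha0 : 0 ≤ a) (ha1 : a < 1) (hb1 : ((1 : ℝ) : EReal) < b)
    (hconv : ConvexOn ℝ (Dom a b) f) (hf1 : f 1 = 0)
    (hstrict : ∃ ε > 0, Set.Ioo (1 - ε) (1 + ε) ⊆ Dom a b ∧
      StrictConvexOn ℝ (Set.Ioo (1 - ε) (1 + ε)) f)
    (hz : zz f + β - α ∈ interior {z : ℝ | fStar f a b z < ⊤})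
    (hαβ : α ≤ β)
    (Γt Γ : Set (X → ℝ)) (hsub : Γt ⊆ Γ) (hΓtne : Γt.Nonempty)
    (hcont : ∀ h ∈ Γ, Continuous h) (hbd : ∀ h ∈ Γ, ∀ x, h x ∈ Set.Icc α β)
    (hΓd : PtwiseDenseCount Γ) (hΓtd : PtwiseDenseCount Γt)
    {Z : Type*} [MeasurableSpace Z] (PZ : Measure Z) [IsProbabilityMeasure PZ]
    {Θ : Type*} [MetricSpace Θ] [TopologicalSpace.SeparableSpace Θ] [Nonempty Θ]
    [MeasurableSpace Θ] [BorelSpace Θ]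
    (Φ : Θ → Z → X) (hΦm : ∀ θ, Measurable (Φ θ)) (hΦc : ∀ z, Continuous fun θ => Φ θ z)
    (Q : Measure X) [IsProbabilityMeasure Q]
    {Ω : Type*} [MeasurableSpace Ω] (ℙ : Measure Ω) [IsProbabilityMeasure ℙ]
    (n m : ℕ) (hn : 0 < n) (hm : 0 < m)
    (Xs : Fin n → Ω → X) (Zs : Fin m → Ω → Z)
    (hXm : ∀ i, Measurable (Xs i)) (hZm : ∀ j, Measurable (Zs j))
    (hlaw : Measure.map (fun ω => (fun i => Xs i ω, fun j => Zs j ω)) ℙ =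
      (Measure.pi fun _ : Fin n => Q).prod (Measure.pi fun _ : Fin m => PZ))
    (θstar : Ω → Θ) (hθm : Measurable θstar)
    (εopt : ℝ) (hεopt : 0 ≤ εopt)
    (hopt : ∀ᵐ ω ∂ℙ,
      Dfg f a b Γt (Measure.map (Φ (θstar ω)) (empMeas m fun j => Zs j ω))
          (empMeas n fun i => Xs i ω) ≤
        (⨅ θ : Θ, Dfg f a b Γt (Measure.map (Φ θ) (empMeas m fun j => Zs j ω))
          (empMeas n fun i => Xs i ω)) + εopt)
    (hzero : ∀ xs : Fin n → X,
      (⨅ θ : Θ, Dfg f a b Γt (Measure.map (Φ θ) PZ) (empMeas n xs)) = 0) :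
    ∀ᵐ ω ∂ℙ,
      Dfg f a b Γ (Measure.map (Φ (θstar ω)) PZ) Q ≤
        sSup {r : ℝ | ∃ h ∈ Γt, ∃ θ : Θ,
            r = (∫ z, h (Φ θ z) ∂PZ) - ∫ z, h (Φ θ z) ∂(empMeas m fun j => Zs j ω)}
        + sSup {r : ℝ | ∃ h ∈ Γt, ∃ θ : Θ,
            r = (∫ z, h (Φ θ z) ∂(empMeas m fun j => Zs j ω)) - ∫ z, h (Φ θ z) ∂PZ}
        + sSup {r : ℝ | ∃ h ∈ Γt,
            r = cgfR f a b (empMeas n fun i => Xs i ω) h - cgfR f a b Q h}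
        + (1 + rderiv (fStarR f a b) (zz f + β - α)) * approxErr Γ Γt
        + εopt := by
  obtain ⟨ε, hε, hεD, -⟩ := hstrict
  have hint : (1 : ℝ) ∈ interior (Dom a b) :=
    mem_interior.2 ⟨_, hεD, isOpen_Ioo, by constructor <;> linarith⟩
  have h1 : (1 : ℝ) ∈ Dom a b := interior_subset hint
  have hsg : ∀ t ∈ Dom a b, zz f * (t - 1) ≤ f t := fun t ht => zz_mul_le hconv hint hf1 ht
  have hD : 1 ≤ rderiv (fStarR f a b) (zz f + β - α) :=
    one_le_rderiv_fStarR h1 hf1 hsg (by linarith) hz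
  have hmeas : ∀ h ∈ Γ, Measurable h := fun h hh => (hcont h hh).measurable
  have hQn : ∀ xs : Fin n → X, IsProbabilityMeasure (empMeas n xs) :=
    isProbabilityMeasure_empMeas hn
  have hZn : ∀ zs : Fin m → Z, IsProbabilityMeasure (empMeas m zs) :=
    isProbabilityMeasure_empMeas hm
  have hmap : ∀ (μ : Measure Z) [IsProbabilityMeasure μ] θ,
      IsProbabilityMeasure (Measure.map (Φ θ) μ) := fun μ _ θ =>
    Measure.isProbabilityMeasure_map (hΦm θ).aemeasurable
  have hintmap : ∀ (μ : Measure Z) θ, ∀ h ∈ Γ,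
      ∫ x, h x ∂(Measure.map (Φ θ) μ) = ∫ z, h (Φ θ z) ∂μ := fun μ θ h hh =>
    integral_map (hΦm θ).aemeasurable (hmeas h hh).aestronglyMeasurable
  have hI : ∀ (μ : Measure Z) [IsProbabilityMeasure μ], ∀ h ∈ Γ, ∀ θ,
      ∫ z, h (Φ θ z) ∂μ ∈ Icc α β := fun μ _ h hh θ =>
    integral_mem_Icc ((hmeas h hh).comp (hΦm θ)) fun z => hbd h hh _
  have hΛ : ∀ (P : Measure X) [IsProbabilityMeasure P], ∀ h ∈ Γ,
      cgfR f a b P h ∈ Icc α β := fun P _ h hh =>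
    cgfR_mem_Icc ha0 h1 hf1 hsg (hmeas h hh) (hbd h hh)
  have hDbdd : ∀ (μ : Measure Z) [IsProbabilityMeasure μ] (P : Measure X)
      [IsProbabilityMeasure P] θ, BddAbove {r : ℝ | ∃ h ∈ Γt,
        r = ∫ x, h x ∂(Measure.map (Φ θ) μ) - cgfR f a b P h} := by
    rintro μ _ P _ θ
    refine ⟨β - α, ?_⟩
    rintro r ⟨h, hh, rfl⟩
    rw [hintmap μ θ h (hsub hh)]
    linarith [(hI μ h (hsub hh) θ).2, (hΛ P h (hsub hh)).1]
  obtain ⟨h₀, hh₀⟩ := hΓtne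
  filter_upwards [hopt] with ω hω
  set μ := empMeas m fun j => Zs j ω
  set P := empMeas n fun i => Xs i ω
  have : IsProbabilityMeasure μ := hZn _
  have : IsProbabilityMeasure P := hQn _
  set S₁ := sSup {r : ℝ | ∃ h ∈ Γt, ∃ θ : Θ,
    r = (∫ z, h (Φ θ z) ∂PZ) - ∫ z, h (Φ θ z) ∂μ}
  set S₂ := sSup {r : ℝ | ∃ h ∈ Γt, ∃ θ : Θ,
    r = (∫ z, h (Φ θ z) ∂μ) - ∫ z, h (Φ θ z) ∂PZ}
  set S₃ := sSup {r : ℝ | ∃ h ∈ Γt, r = cgfR f a b P h - cgfR f a b Q h}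
  have hS₁ : ∀ h ∈ Γt, ∀ θ, (∫ z, h (Φ θ z) ∂PZ) - ∫ z, h (Φ θ z) ∂μ ≤ S₁ := by
    refine fun h hh θ => le_csSup ⟨β - α, ?_⟩ ⟨h, hh, θ, rfl⟩
    rintro r ⟨h, hh, θ, rfl⟩
    linarith [(hI PZ h (hsub hh) θ).2, (hI μ h (hsub hh) θ).1]
  have hS₂ : ∀ h ∈ Γt, ∀ θ, (∫ z, h (Φ θ z) ∂μ) - ∫ z, h (Φ θ z) ∂PZ ≤ S₂ := by
    refine fun h hh θ => le_csSup ⟨β - α, ?_⟩ ⟨h, hh, θ, rfl⟩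
    rintro r ⟨h, hh, θ, rfl⟩
    linarith [(hI μ h (hsub hh) θ).2, (hI PZ h (hsub hh) θ).1]
  have hS₃ : ∀ h ∈ Γt, cgfR f a b P h - cgfR f a b Q h ≤ S₃ := by
    refine fun h hh => le_csSup ⟨β - α, ?_⟩ ⟨h, hh, rfl⟩
    rintro r ⟨h, hh, rfl⟩
    linarith [(hΛ P h (hsub hh)).2, (hΛ Q h (hsub hh)).1]
  have hDle : ∀ θ, Dfg f a b Γt (Measure.map (Φ θ) μ) P ≤
      Dfg f a b Γt (Measure.map (Φ θ) PZ) P + S₂ := by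
    refine fun θ => csSup_le ⟨_, h₀, hh₀, rfl⟩ ?_
    rintro r ⟨h, hh, rfl⟩
    have hle : _ ≤ Dfg f a b Γt (Measure.map (Φ θ) PZ) P :=
      le_csSup (hDbdd PZ P θ) ⟨h, hh, rfl⟩
    rw [hintmap _ θ h (hsub hh)] at hle ⊢
    linarith [hS₂ h hh θ]
  have hbelow : BddBelow (range fun θ => Dfg f a b Γt (Measure.map (Φ θ) μ) P) := by
    refine ⟨α - β, ?_⟩
    rintro _ ⟨θ, rfl⟩
    have hle : _ ≤ Dfg f a b Γt (Measure.map (Φ θ) μ) P :=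
      le_csSup (hDbdd μ P θ) ⟨h₀, hh₀, rfl⟩
    rw [hintmap _ θ h₀ (hsub hh₀)] at hle
    linarith [(hI μ h₀ (hsub hh₀) θ).1, (hΛ P h₀ (hsub hh₀)).2]
  have hinf : (⨅ θ : Θ, Dfg f a b Γt (Measure.map (Φ θ) μ) P) ≤ S₂ := by
    have hle : (⨅ θ : Θ, Dfg f a b Γt (Measure.map (Φ θ) μ) P) - S₂ ≤
        ⨅ θ : Θ, Dfg f a b Γt (Measure.map (Φ θ) PZ) P :=
      le_ciInf fun θ => by linarith [ciInf_le hbelow θ, hDle θ]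
    linarith [hzero fun i => Xs i ω]
  refine csSup_le ⟨_, h₀, hsub hh₀, rfl⟩ ?_
  rintro r ⟨h, hh, rfl⟩
  rw [hintmap _ _ h hh]
  have herr : 0 ≤ approxErr Γ Γt := by
    refine Real.sSup_nonneg ?_
    rintro r ⟨h, -, rfl⟩
    refine Real.sInf_nonneg ?_
    rintro s ⟨k, -, rfl⟩
    exact Real.iSup_nonneg fun x => abs_nonneg _
  have hmul : 2 * approxErr Γ Γt ≤
      (1 + rderiv (fStarR f a b) (zz f + β - α)) * approxErr Γ Γt :=
    mul_le_mul_of_nonneg_right (by linarith) herr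
  refine le_of_forall_pos_le_add fun δ hδ => ?_
  obtain ⟨k, hk, hhk⟩ := exists_abs_sub_le_approxErr_add ⟨h₀, hh₀⟩ hbd
    (fun h hh => hbd h (hsub hh)) hh (half_pos hδ)
  have hkΓ := hsub hk
  have hE : ∫ z, h (Φ (θstar ω) z) ∂PZ ≤
      ∫ z, k (Φ (θstar ω) z) ∂PZ + (approxErr Γ Γt + δ / 2) := by
    have hik : Integrable (fun z => k (Φ (θstar ω) z)) PZ :=
      integrable_of_mem_Icc ((hmeas k hkΓ).comp (hΦm _)) fun z => hbd k hkΓ _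
    have hih : Integrable (fun z => h (Φ (θstar ω) z)) PZ :=
      integrable_of_mem_Icc ((hmeas h hh).comp (hΦm _)) fun z => hbd h hh _
    have hle := integral_mono hih (hik.add (integrable_const (approxErr Γ Γt + δ / 2)))
      fun z => by
        have := (abs_le.1 (hhk (Φ (θstar ω) z))).2
        simp only [Pi.add_apply]
        linarith
    simpa [integral_add hik (integrable_const _)] using hle
  have hL : cgfR f a b Q k ≤ cgfR f a b Q h + (approxErr Γ Γt + δ / 2) :=
    cgfR_le_cgfR_add ha0 h1 hf1 hsg (hmeas k hkΓ) (hbd k hkΓ) (hmeas h hh) (hbd h hh)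
      fun x => by linarith [(abs_le.1 (hhk x)).1]
  have hDk : _ ≤ Dfg f a b Γt (Measure.map (Φ (θstar ω)) μ) P :=
    le_csSup (hDbdd μ P (θstar ω)) ⟨k, hk, rfl⟩
  rw [hintmap _ _ k hkΓ] at hDk
  linarith [hS₁ k hk (θstar ω), hS₃ k hk]
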